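/- arXiv:0801.3105 — 2 statements merged into one kernel-verified Lean document; each statement's English description precedes it below -/
import Mathlib

section
/- Let I ⊆ R = ℂ[x_1,…,x_n] be generated by f_1,…,f_N, and let I^{(d)} ⊆ S be the deflation ideal of order d ≥ 1 built from these generators. For every multi-index α ∈ ℕ^n and every j = 1,…,N, the polynomial χ^α Q_a · f_j := Σ_{β ≥ α, |β| ≤ d} (β!/(β−α)!) · a_β · ∂^{β−α} f_j (the image of f_j under the α-th formal derivative in ∂ of the operator Q_a = Σ_{|β| ≤ d} a_β ∂^β) lies in I^{(d)}. -/
open MvPolynomial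

noncomputable section NPD
/-- The iterated partial derivative `∂^β = ∂^{|β|}/∂x₁^{β₁}⋯∂xₙ^{βₙ}` on
`R = ℂ[x₁,…,xₙ]`, as a `ℂ`-linear endomorphism. -/
def pd {n : ℕ} (β : Fin n →₀ ℕ) : Module.End ℂ (MvPolynomial (Fin n) ℂ) :=
  (List.ofFn fun i : Fin n =>
    ((pderiv i).toLinearMap : Module.End ℂ (MvPolynomial (Fin n) ℂ)) ^ (β i)).prod
/-- The index type for the deflation variables `a_β`: multi-indices `β` with `|β| ≤ d`. -/
def AIdx (n d : ℕ) : Type := {β : Fin n →₀ ℕ // β.degree ≤ d}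

noncomputable instance AIdx.fintype (n d : ℕ) : Fintype (AIdx n d) := by
  have hfin : {β : Fin n →₀ ℕ | β.degree ≤ d}.Finite := by
    apply Set.Finite.subset
      (Finset.Iic (Finsupp.equivFunOnFinite.symm fun _ : Fin n => d)).finite_toSet
    intro β hβ
    simp only [Finset.coe_Iic, Set.mem_Iic]
    rw [Finsupp.le_def]
    intro i
    simpa using le_trans (Finsupp.le_degree i β) hβ
  exact hfin.fintype

/-- The generator `Σ_{|β| ≤ d} a_β · ∂^β g` of the deflation ideal attached to a
polynomial `g`, an element of `S = R[a_β : |β| ≤ d]`. -/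
def deflGen {n : ℕ} (d : ℕ) (g : MvPolynomial (Fin n) ℂ) :
    MvPolynomial (Fin n ⊕ AIdx n d) ℂ :=
  ∑ β : AIdx n d, X (Sum.inr β) * rename Sum.inl (pd β.1 g)

/-- The deflation ideal `I^{(d)} ⊆ S` of order `d` of the ideal generated by
`f 0, …, f (N-1)`: it is generated by the `f j` together with the polynomials
`Σ_{|β| ≤ d} a_β · ∂^β (x^α f j)` for all `j` and all multi-indices `α` with `|α| < d`. -/
def deflIdeal {n : ℕ} (d : ℕ) {N : ℕ} (f : Fin N → MvPolynomial (Fin n) ℂ) :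
    Ideal (MvPolynomial (Fin n ⊕ AIdx n d) ℂ) :=
  Ideal.span
    ((Set.range fun j : Fin N => (rename Sum.inl (f j) : MvPolynomial (Fin n ⊕ AIdx n d) ℂ)) ∪
      Set.range fun p : Fin N × {α : Fin n →₀ ℕ // α.degree < d} =>
        deflGen d (monomial p.2.1 1 * f p.1))
theorem pow_mul_of_mul_eq_mul_add_one {A : Type*} [Ring A] {D x : A} (h : D * x = x * D + 1)
    (k : ℕ) : D ^ k * x = x * D ^ k + k • D ^ (k - 1) := by
  induction k with
  | zero => simp
  | succ k ih =>
    have hk : k • (D * D ^ (k - 1)) = k • D ^ k := by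
      cases k with
      | zero => simp
      | succ k => rw [Nat.add_sub_cancel, pow_succ']
    rw [pow_succ', mul_assoc, ih, mul_add, ← mul_assoc, h, mul_smul_comm, hk, Nat.add_sub_cancel,
      add_mul, one_mul, mul_assoc, succ_nsmul]
    abel

/-- Leibniz rule for commuting `x` past an ordered product in which only the `i`-th factor fails
to commute with `x`. -/
theorem prod_ofFn_mul_eq {A : Type*} [Ring A] (x : A) (c : ℕ) {n : ℕ} (u v : Fin n → A)
    (i : Fin n) (huv : ∀ k, k ≠ i → u k = v k) (hcomm : ∀ k, k ≠ i → u k * x = x * u k)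
    (hi : u i * x = x * u i + c • v i) :
    (List.ofFn u).prod * x = x * (List.ofFn u).prod + c • (List.ofFn v).prod := by
  induction n with
  | zero => exact i.elim0
  | succ n ih =>
    simp only [List.ofFn_succ, List.prod_cons]
    cases i using Fin.cases with
    | zero =>
      have hs : (fun k : Fin n => u k.succ) = fun k => v k.succ :=
        funext fun k => huv _ (Fin.succ_ne_zero k)
      have hx : Commute (List.ofFn fun k : Fin n => u k.succ).prod x := by
        refine Commute.list_prod_left _ _ fun y hy => ?_
        obtain ⟨k, rfl⟩ := List.mem_ofFn.mp hy
        exact hcomm _ (Fin.succ_ne_zero k)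
      rw [mul_assoc, hx.eq, ← mul_assoc, hi, ← hs, add_mul, smul_mul_assoc, mul_assoc]
    | succ i =>
      have h0 : (0 : Fin (n + 1)) ≠ i.succ := (Fin.succ_ne_zero i).symm
      rw [mul_assoc, ih (fun k => u k.succ) (fun k => v k.succ) i
        (fun k hk => huv _ (by simpa using hk)) (fun k hk => hcomm _ (by simpa using hk)) hi,
        mul_add, ← mul_assoc, hcomm 0 h0, mul_smul_comm, huv 0 h0, mul_assoc]

theorem pd_X_mul {n : ℕ} (γ : Fin n →₀ ℕ) (i : Fin n) (g : MvPolynomial (Fin n) ℂ) :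
    pd γ (X i * g) = X i * pd γ g + γ i • pd (γ - Finsupp.single i 1) g := by
  have hD : ∀ k, ((pderiv k).toLinearMap : Module.End ℂ (MvPolynomial (Fin n) ℂ)) *
      LinearMap.mulLeft ℂ (X i) = LinearMap.mulLeft ℂ (X i) * (pderiv k).toLinearMap +
        if k = i then 1 else 0 := by
    intro k
    refine LinearMap.ext fun p => ?_
    by_cases hk : k = i
    · subst hk
      simp [Derivation.leibniz, add_comm]
    · simp [Derivation.leibniz, hk, pderiv_X_of_ne (Ne.symm hk)]
  have key := prod_ofFn_mul_eq (LinearMap.mulLeft ℂ (X i)) (γ i)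
    (fun k => ((pderiv k).toLinearMap : Module.End ℂ (MvPolynomial (Fin n) ℂ)) ^ γ k)
    (fun k => (pderiv k).toLinearMap ^ (γ - Finsupp.single i 1 : Fin n →₀ ℕ) k) i
    (fun k hk => by simp [Finsupp.single_eq_of_ne hk])
    (fun k hk => by
      have h : Commute ((pderiv k).toLinearMap : Module.End ℂ (MvPolynomial (Fin n) ℂ))
          (LinearMap.mulLeft ℂ (X i)) := by
        simpa [hk, Commute, SemiconjBy] using hD k
      exact (h.pow_left _).eq)
    (by
      have h := pow_mul_of_mul_eq_mul_add_one (by simpa using hD i) (γ i)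
      simpa using h)
  exact LinearMap.congr_fun key g

theorem pd_zero {n : ℕ} (g : MvPolynomial (Fin n) ℂ) : pd 0 g = g := by
  simp [pd]

/-- The polynomial `χ^α Q_a · g`. -/
def chiDeriv {n : ℕ} (d : ℕ) (α : Fin n →₀ ℕ) (g : MvPolynomial (Fin n) ℂ) :
    MvPolynomial (Fin n ⊕ AIdx n d) ℂ :=
  ∑ β : AIdx n d, (∏ i, (β.1 i).descFactorial (α i)) •
    (X (Sum.inr β) * rename Sum.inl (pd (β.1 - α) g))

theorem chiDeriv_zero {n : ℕ} (d : ℕ) (g : MvPolynomial (Fin n) ℂ) :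
    chiDeriv d 0 g = deflGen d g := by
  simp [chiDeriv, deflGen]

theorem prod_descFactorial_add_single {n : ℕ} (β α : Fin n →₀ ℕ) (i : Fin n) :
    ∏ k, (β k).descFactorial ((α + Finsupp.single i 1 : Fin n →₀ ℕ) k) =
      (∏ k, (β k).descFactorial (α k)) * (β - α) i := by
  rw [← Finset.mul_prod_erase _ _ (Finset.mem_univ i),
    ← Finset.mul_prod_erase (a := i) _ (fun k => (β k).descFactorial (α k)) (Finset.mem_univ i)]
  have h : ∀ k ∈ Finset.univ.erase i, (β k).descFactorial ((α + Finsupp.single i 1 : Fin n →₀ ℕ) k) =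
      (β k).descFactorial (α k) := by
    intro k hk
    simp [Finsupp.single_eq_of_ne (Finset.ne_of_mem_erase hk)]
  rw [Finset.prod_congr rfl h]
  simp only [Finsupp.add_apply, Finsupp.single_eq_same, Nat.descFactorial_succ,
    Finsupp.tsub_apply]
  ring

theorem chiDeriv_X_mul {n : ℕ} (d : ℕ) (α : Fin n →₀ ℕ) (i : Fin n)
    (g : MvPolynomial (Fin n) ℂ) :
    chiDeriv d α (X i * g) =
      X (Sum.inl i) * chiDeriv d α g + chiDeriv d (α + Finsupp.single i 1) g := by
  simp only [chiDeriv]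
  rw [Finset.mul_sum, ← Finset.sum_add_distrib]
  refine Finset.sum_congr rfl fun β _ => ?_
  rw [pd_X_mul, prod_descFactorial_add_single, tsub_tsub]
  simp only [map_add, map_mul, map_natCast, rename_X, nsmul_eq_mul, Nat.cast_mul]
  ring

theorem induction_on_add_single_one {σ : Type*} {p : (σ →₀ ℕ) → Prop} (α : σ →₀ ℕ)
    (zero : p 0) (add_single : ∀ α i, p α → p (α + Finsupp.single i 1)) : p α := by
  induction h : α.degree generalizing α with
  | zero => rwa [(Finsupp.degree_eq_zero_iff α).mp h]
  | succ k ih =>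
    obtain ⟨i, hi⟩ : ∃ i, α i ≠ 0 := by
      by_contra! h0
      rw [(Finsupp.ext h0 : α = 0), map_zero] at h
      omega
    have hα : α - Finsupp.single i 1 + Finsupp.single i 1 = α :=
      tsub_add_cancel_of_le (by simpa [Nat.one_le_iff_ne_zero] using hi)
    have hdeg := congrArg Finsupp.degree hα
    rw [map_add, Finsupp.degree_single] at hdeg
    rw [← hα]
    exact add_single _ i (ih _ (by omega))

theorem chiDeriv_monomial_mul_mem {n N : ℕ} (f : Fin N → MvPolynomial (Fin n) ℂ) (d : ℕ)
    (j : Fin N) (α : Fin n →₀ ℕ) : ∀ γ : Fin n →₀ ℕ, α.degree + γ.degree < d →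
      chiDeriv d α (monomial γ 1 * f j) ∈ deflIdeal d f := by
  induction α using induction_on_add_single_one with
  | zero =>
    intro γ h
    rw [chiDeriv_zero]
    exact Ideal.subset_span (Or.inr ⟨(j, ⟨γ, by simpa using h⟩), rfl⟩)
  | add_single α i ih =>
    intro γ h
    simp only [map_add, Finsupp.degree_single] at h
    rw [← sub_eq_of_eq_add' (chiDeriv_X_mul d α i _)]
    refine Ideal.sub_mem _ ?_ (Ideal.mul_mem_left _ _ (ih γ (by omega)))
    have hm : X i * (monomial γ 1 * f j) = monomial (Finsupp.single i 1 + γ) 1 * f j := by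
      rw [← mul_assoc, X, monomial_mul, one_mul]
    rw [hm]
    exact ih _ (by simp only [map_add, Finsupp.degree_single]; omega)

theorem chiDeriv_mem_of_le_degree {n N : ℕ} (f : Fin N → MvPolynomial (Fin n) ℂ) (d : ℕ)
    (j : Fin N) (α : Fin n →₀ ℕ) (h : d ≤ α.degree) :
    chiDeriv d α (f j) ∈ deflIdeal d f := by
  refine Ideal.sum_mem _ fun β _ => ?_
  by_cases hle : α ≤ β.1
  · have hβ : β.1 - α = 0 := by
      have hdeg := congrArg Finsupp.degree (tsub_add_cancel_of_le hle)
      have hβd := β.2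
      rw [map_add] at hdeg
      exact (Finsupp.degree_eq_zero_iff _).mp (by omega)
    rw [hβ, pd_zero]
    refine nsmul_mem ?_ _
    exact Ideal.mul_mem_left _ _ (Ideal.subset_span (Or.inl ⟨j, rfl⟩))
  · obtain ⟨i, hi⟩ : ∃ i, ¬α i ≤ β.1 i := by simpa [Finsupp.le_def] using hle
    rw [Finset.prod_eq_zero (Finset.mem_univ i)
      (Nat.descFactorial_eq_zero_iff_lt.mpr (not_le.mp hi)), zero_smul]
    exact Ideal.zero_mem _

/-- **Lemma (derivative of `Q`).** For every multi-index `α` and every generator `f j`,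
the polynomial `χ^α Q_a · f_j = Σ_{β ≥ α, |β| ≤ d} (β!/(β−α)!) a_β ∂^{β−α} f_j` lies in the
deflation ideal `I^{(d)}`.  (Here `(β.1 i).descFactorial (α i) = β_i!/(β_i − α_i)!` vanishes
unless `α ≤ β`, so the sum below effectively runs over `β ≥ α` with `|β| ≤ d`.) -/
theorem chi_deriv_mem_deflIdeal {n N : ℕ} (f : Fin N → MvPolynomial (Fin n) ℂ)
    (d : ℕ) (hd : 1 ≤ d) (α : Fin n →₀ ℕ) (j : Fin N) :
    (∑ β : AIdx n d, (∏ i, (β.1 i).descFactorial (α i)) •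
        (X (Sum.inr β) * rename Sum.inl (pd (β.1 - α) (f j))) :
      MvPolynomial (Fin n ⊕ AIdx n d) ℂ) ∈ deflIdeal d f := by
  rcases lt_or_ge α.degree d with h | h
  · simpa [chiDeriv] using chiDeriv_monomial_mul_mem f d j α 0 (by simpa using h)
  · exact chiDeriv_mem_of_le_degree f d j α h
end NPD
end

section
/- Let I ⊆ R = ℂ[x_1,…,x_n] be generated by f_1,…,f_N, and let I^{(d)} ⊆ S be the deflation ideal of order d ≥ 1 built from these generators. Then for every polynomial h ∈ I, the polynomial Σ_{|β| ≤ d} a_β · ∂^β h lies in I^{(d)}. -/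
open MvPolynomial

noncomputable section NPD
/-- The commutator `h ↦ E (xᵢ h) - xᵢ E h` of a linear map `E` on polynomials with the
multiplication by the variable `xᵢ`. -/
def varCommutator {σ R A : Type*} [CommRing R] [CommRing A] [Algebra R A]
    (φ : MvPolynomial σ R →ₐ[R] A) (i : σ) (E : MvPolynomial σ R →ₗ[R] A) :
    MvPolynomial σ R →ₗ[R] A :=
  E ∘ₗ LinearMap.mulLeft R (X i) - φ (X i) • E

/-- Differential operators of order at most `k` along `φ`, in the sense of Grothendieck:
the `k`-fold commutators with variables are multiplication operators. -/
def HasOrderLE {σ R A : Type*} [CommRing R] [CommRing A] [Algebra R A]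
    (φ : MvPolynomial σ R →ₐ[R] A) : ℕ → (MvPolynomial σ R →ₗ[R] A) → Prop
  | 0, E => ∃ c, ∀ h, E h = c * φ h
  | k + 1, E => ∀ i, HasOrderLE φ k (varCommutator φ i E)

section DifferentialOperators

variable {σ R A : Type*} [CommRing R] [CommRing A] [Algebra R A]
  {φ : MvPolynomial σ R →ₐ[R] A}

theorem varCommutator_apply (i : σ) (E : MvPolynomial σ R →ₗ[R] A) (h : MvPolynomial σ R) :
    varCommutator φ i E h = E (X i * h) - φ (X i) * E h := rfl

theorem HasOrderLE.add {k : ℕ} {E F : MvPolynomial σ R →ₗ[R] A}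
    (hE : HasOrderLE φ k E) (hF : HasOrderLE φ k F) : HasOrderLE φ k (E + F) := by
  induction k generalizing E F with
  | zero =>
    obtain ⟨c, hc⟩ := hE
    obtain ⟨c', hc'⟩ := hF
    exact ⟨c + c', fun h => by rw [LinearMap.add_apply, hc, hc', add_mul]⟩
  | succ k ih =>
    intro i
    have : varCommutator φ i (E + F) = varCommutator φ i E + varCommutator φ i F := by
      refine LinearMap.ext fun h => ?_
      simp only [varCommutator_apply, LinearMap.add_apply]
      ring
    rw [this]
    exact ih (hE i) (hF i)

theorem HasOrderLE.smul {k : ℕ} {E : MvPolynomial σ R →ₗ[R] A} (hE : HasOrderLE φ k E) (a : A) :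
    HasOrderLE φ k (a • E) := by
  induction k generalizing E with
  | zero =>
    obtain ⟨c, hc⟩ := hE
    exact ⟨a * c, fun h => by rw [LinearMap.smul_apply, hc, smul_eq_mul, mul_assoc]⟩
  | succ k ih =>
    intro i
    have : varCommutator φ i (a • E) = a • varCommutator φ i E := by
      refine LinearMap.ext fun h => ?_
      simp only [varCommutator_apply, LinearMap.smul_apply, smul_eq_mul]
      ring
    rw [this]
    exact ih (hE i)

theorem HasOrderLE.zero (k : ℕ) : HasOrderLE φ k (0 : MvPolynomial σ R →ₗ[R] A) := by
  induction k with
  | zero => exact ⟨0, fun h => by simp⟩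
  | succ k ih =>
    intro i
    have : varCommutator φ i (0 : MvPolynomial σ R →ₗ[R] A) = 0 :=
      LinearMap.ext fun h => by simp [varCommutator_apply]
    rwa [this]

theorem HasOrderLE.sum {ι : Type*} {k : ℕ} (s : Finset ι) {E : ι → MvPolynomial σ R →ₗ[R] A}
    (hE : ∀ j ∈ s, HasOrderLE φ k (E j)) : HasOrderLE φ k (∑ j ∈ s, E j) :=
  Finset.sum_induction E (HasOrderLE φ k) (fun _ _ => HasOrderLE.add) (HasOrderLE.zero k) hE

theorem HasOrderLE.succ {k : ℕ} {E : MvPolynomial σ R →ₗ[R] A} (hE : HasOrderLE φ k E) :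
    HasOrderLE φ (k + 1) E := by
  induction k generalizing E with
  | zero =>
    obtain ⟨c, hc⟩ := hE
    refine fun i => ⟨0, fun h => ?_⟩
    rw [varCommutator_apply, hc, hc, map_mul]
    ring
  | succ k ih => exact fun i => ih (hE i)

theorem HasOrderLE.mono {k l : ℕ} (hkl : k ≤ l) {E : MvPolynomial σ R →ₗ[R] A}
    (hE : HasOrderLE φ k E) : HasOrderLE φ l E :=
  Nat.le_induction hE (fun _ _ => HasOrderLE.succ) l hkl

theorem HasOrderLE.comp_pderiv {k : ℕ} {E : MvPolynomial σ R →ₗ[R] A} (hE : HasOrderLE φ k E)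
    (j : σ) : HasOrderLE φ (k + 1) (E ∘ₗ (pderiv j).toLinearMap) := by
  classical
  have key (E : MvPolynomial σ R →ₗ[R] A) (i : σ) :
      varCommutator φ i (E ∘ₗ (pderiv j).toLinearMap) =
        (if i = j then (1 : A) else 0) • E +
          varCommutator φ i E ∘ₗ (pderiv j).toLinearMap := by
    refine LinearMap.ext fun h => ?_
    rcases eq_or_ne i j with rfl | hij
    · simp [varCommutator_apply, Derivation.leibniz]
      ring
    · simp [varCommutator_apply, Derivation.leibniz, pderiv_X_of_ne hij, hij]
  induction k generalizing E with
  | zero =>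
    intro i
    obtain ⟨c, hc⟩ := hE
    have hcomm : varCommutator φ i E = 0 := by
      refine LinearMap.ext fun h => ?_
      rw [varCommutator_apply, hc, hc, map_mul, LinearMap.zero_apply]
      ring
    rw [key, hcomm, LinearMap.zero_comp, add_zero]
    exact HasOrderLE.smul (k := 0) ⟨c, hc⟩ _
  | succ k ih =>
    intro i
    rw [key]
    exact (hE.smul _).add (ih (hE i))

theorem HasOrderLE.comp_pderiv_pow {k : ℕ} {E : MvPolynomial σ R →ₗ[R] A}
    (hE : HasOrderLE φ k E) (j : σ) (m : ℕ) :
    HasOrderLE φ (k + m)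
      (E ∘ₗ ((pderiv j).toLinearMap : Module.End R (MvPolynomial σ R)) ^ m) := by
  induction m with
  | zero => exact hE
  | succ m ih =>
    rw [pow_succ]
    exact ih.comp_pderiv j

theorem HasOrderLE.comp_prod_ofFn {k m : ℕ} {E : MvPolynomial σ R →ₗ[R] A}
    (hE : HasOrderLE φ k E) (v : Fin m → σ) (b : Fin m → ℕ) :
    HasOrderLE φ (k + ∑ i, b i)
      (E ∘ₗ (List.ofFn fun i =>
        ((pderiv (v i)).toLinearMap : Module.End R (MvPolynomial σ R)) ^ b i).prod) := by
  induction m generalizing k E with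
  | zero => simpa [Module.End.one_eq_id] using hE
  | succ m ih =>
    rw [List.ofFn_succ, List.prod_cons, Fin.sum_univ_succ, ← add_assoc]
    exact ih (hE.comp_pderiv_pow (v 0) (b 0)) (fun i => v i.succ) (fun i => b i.succ)

/-- If `E` has order at most `k`, then membership of `E (g * f)` in an ideal containing `φ f`
only has to be checked for the monomials `g` of degree less than `k`. -/
theorem HasOrderLE.apply_mul_mem {k : ℕ} {E : MvPolynomial σ R →ₗ[R] A}
    (hE : HasOrderLE φ k E) {J : Ideal A} {f : MvPolynomial σ R} (hf : φ f ∈ J)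
    (hmon : ∀ α : σ →₀ ℕ, α.degree < k → E (monomial α 1 * f) ∈ J) (g : MvPolynomial σ R) :
    E (g * f) ∈ J := by
  induction k generalizing E g with
  | zero =>
    obtain ⟨c, hc⟩ := hE
    rw [hc, map_mul]
    exact J.mul_mem_left _ (J.mul_mem_left _ hf)
  | succ k ih =>
    induction g using MvPolynomial.induction_on with
    | C a =>
      rw [← smul_eq_C_mul, map_smul, Algebra.smul_def]
      refine J.mul_mem_left _ ?_
      simpa using hmon 0 (by simp)
    | add p q hp hq =>
      rw [add_mul, map_add]
      exact J.add_mem hp hq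
    | mul_X p i hp =>
      have hcomm : varCommutator φ i E (p * f) ∈ J := by
        refine ih (hE i) (fun α hα => ?_) p
        rw [varCommutator_apply, ← mul_assoc, X, monomial_mul, one_mul]
        refine J.sub_mem (hmon _ ?_) (J.mul_mem_left _ (hmon α (by omega)))
        rw [map_add, Finsupp.degree_single]
        omega
      rw [mul_comm p, mul_assoc, ← sub_add_cancel (E _) (φ (X i) * E (p * f))]
      exact J.add_mem hcomm (J.mul_mem_left _ hp)

end DifferentialOperators

/-- `deflGen d` as a linear map. -/
def deflGenLinear (n d : ℕ) :
    MvPolynomial (Fin n) ℂ →ₗ[ℂ] MvPolynomial (Fin n ⊕ AIdx n d) ℂ :=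
  ∑ β : AIdx n d, (X (Sum.inr β) : MvPolynomial (Fin n ⊕ AIdx n d) ℂ) •
    ((rename Sum.inl).toLinearMap ∘ₗ pd β.1)

theorem deflGenLinear_apply {n : ℕ} (d : ℕ) (g : MvPolynomial (Fin n) ℂ) :
    deflGenLinear n d g = deflGen d g := by
  simp [deflGenLinear, deflGen, LinearMap.sum_apply]

theorem hasOrderLE_deflGenLinear (n d : ℕ) :
    HasOrderLE (rename Sum.inl) d (deflGenLinear n d) := by
  refine HasOrderLE.sum _ fun β _ => HasOrderLE.smul ?_ _
  have hrename : HasOrderLE (rename Sum.inl) 0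
      (rename Sum.inl : MvPolynomial (Fin n) ℂ →ₐ[ℂ]
        MvPolynomial (Fin n ⊕ AIdx n d) ℂ).toLinearMap :=
    ⟨1, fun h => (one_mul _).symm⟩
  refine (hrename.comp_prod_ofFn id β.1).mono ?_
  rw [zero_add, ← Finsupp.degree_eq_sum]
  exact β.2

/-- For every polynomial `h` in the ideal `I = (f_1,…,f_N)`, the polynomial
`Q_a · h = Σ_{|β| ≤ d} a_β ∂^β h` lies in the deflation ideal `I^{(d)}` of order `d ≥ 1`
built from the generators `f_1,…,f_N`. -/
theorem deflGen_mem_deflIdeal_of_mem {n N : ℕ} (f : Fin N → MvPolynomial (Fin n) ℂ)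
    (d : ℕ) (hd : 1 ≤ d) (h : MvPolynomial (Fin n) ℂ)
    (hh : h ∈ Ideal.span (Set.range f)) :
    deflGen d h ∈ deflIdeal d f := by
  rw [← deflGenLinear_apply]
  obtain ⟨c, rfl⟩ := Ideal.mem_span_range_iff_exists_fun.mp hh
  rw [map_sum]
  refine Ideal.sum_mem _ fun j _ => ?_
  refine (hasOrderLE_deflGenLinear n d).apply_mul_mem
    (Ideal.subset_span (Or.inl ⟨j, rfl⟩)) (fun α hα => ?_) (c j)
  rw [deflGenLinear_apply]
  exact Ideal.subset_span (Or.inr ⟨(j, ⟨α, hα⟩), rfl⟩)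
end NPD
end
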